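/- arXiv:2310.08271 — 5 statements merged into one kernel-verified Lean document; each statement's English description precedes it below -/
import Mathlib

section
/- Let p>1 be an odd integer, τ=2^s a power of two, m=pτ, and let a be a polynomial over 𝔽₂ of degree < m such that gcd(a, x^m+1) = x^τ+1 in 𝔽₂[x]. Then the (m−τ)×(m−τ) binary matrix 𝒜_{τ,τ}(a) has full row rank m−τ over 𝔽₂ (equivalently, it is invertible over 𝔽₂). -/
open Polynomial

/-- The `(m-τ) × (m-τ)` binary matrix `𝒜_{τ,τ}(a)`: the top-left submatrix of the
`m × m` circulant matrix of `a` (whose `(i,j)` entry is the coefficient of `a`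
at `(j - i) mod m`) obtained by deleting the last `τ` rows and columns. -/
noncomputable def Att (m τ : ℕ) (a : Polynomial (ZMod 2)) :
    Matrix (Fin (m - τ)) (Fin (m - τ)) (ZMod 2) :=
  Matrix.of fun i j => a.coeff ((j.1 + (m - i.1)) % m)

theorem X_pow_sub_one_dvd_X_pow_sub_X_pow_mod {R : Type*} [CommRing R] (m N : ℕ) :
    (X ^ m - 1 : R[X]) ∣ X ^ N - X ^ (N % m) := by
  have h : (X ^ N - X ^ (N % m) : R[X]) = X ^ (N % m) * ((X ^ m) ^ (N / m) - 1 ^ (N / m)) := by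
    conv_lhs => rw [← Nat.mod_add_div N m, pow_add, pow_mul]
    simp [mul_sub]
  rw [h]
  exact (sub_dvd_pow_sub_pow _ _ _).mul_left _

/-- Multiplication by `X ^ i` modulo `X ^ m - 1` rotates the coefficients. -/
theorem X_pow_sub_one_dvd_X_pow_mul_sub_rotate {R : Type*} [CommRing R] {m i : ℕ}
    (hi : i ≤ m) {a : R[X]} (ha : a.degree < (m : WithBot ℕ)) :
    (X ^ m - 1 : R[X]) ∣
      X ^ i * a - ∑ k ∈ Finset.range m, C (a.coeff ((k + (m - i)) % m)) * X ^ k := by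
  have hsum : ∑ k ∈ Finset.range m, C (a.coeff ((k + (m - i)) % m)) * X ^ k =
      ∑ l ∈ Finset.range m, C (a.coeff l) * X ^ ((i + l) % m) := by
    have key : ∀ k < m, (i + (k + (m - i)) % m) % m = k := fun k hk => by
      rw [Nat.add_mod_mod, show i + (k + (m - i)) = k + m by omega, Nat.add_mod_right,
        Nat.mod_eq_of_lt hk]
    have key' : ∀ l < m, ((i + l) % m + (m - i)) % m = l := fun l hl => by
      rw [Nat.mod_add_mod, show i + l + (m - i) = l + m by omega, Nat.add_mod_right,
        Nat.mod_eq_of_lt hl]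
    refine Finset.sum_nbij' (fun k => (k + (m - i)) % m) (fun l => (i + l) % m) ?_ ?_ ?_ ?_ ?_
    · intro k hk
      exact Finset.mem_range.2 (Nat.mod_lt _ (by have := Finset.mem_range.1 hk; omega))
    · intro k hk
      exact Finset.mem_range.2 (Nat.mod_lt _ (by have := Finset.mem_range.1 hk; omega))
    · intro k hk
      exact key k (Finset.mem_range.1 hk)
    · intro l hl
      exact key' l (Finset.mem_range.1 hl)
    · intro k hk
      simp only [key k (Finset.mem_range.1 hk)]
  have hexp : a = ∑ l ∈ Finset.range m, C (a.coeff l) * X ^ l := by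
    ext n
    simp only [finsetSum_coeff, coeff_C_mul_X_pow, Finset.sum_ite_eq, Finset.mem_range]
    split_ifs with h
    · rfl
    · exact coeff_eq_zero_of_degree_lt (ha.trans_le (by exact_mod_cast not_lt.1 h))
  rw [hsum]
  nth_rewrite 1 [hexp]
  rw [Finset.mul_sum, ← Finset.sum_sub_distrib]
  refine Finset.dvd_sum fun l _ => ?_
  rw [show X ^ i * (C (a.coeff l) * X ^ l) - C (a.coeff l) * X ^ ((i + l) % m) =
    C (a.coeff l) * (X ^ (i + l) - X ^ ((i + l) % m) : R[X]) by ring]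
  exact (X_pow_sub_one_dvd_X_pow_sub_X_pow_mod m _).mul_left _

theorem eq_zero_of_X_pow_add_one_dvd_X_pow_mul {K : Type*} [Field K] {τ : ℕ} (hτ : 0 < τ)
    (n : ℕ) {u : K[X]} (hu : u.degree < (τ : WithBot ℕ)) (h : X ^ τ + 1 ∣ X ^ n * u) :
    u = 0 := by
  have hco : IsCoprime (X ^ τ + 1 : K[X]) (X ^ n) := by
    refine IsCoprime.pow_right ⟨1, -X ^ (τ - 1), ?_⟩
    rw [neg_mul, ← pow_succ, Nat.sub_add_cancel hτ]
    ring
  refine eq_zero_of_dvd_of_degree_lt (hco.dvd_of_dvd_mul_left h) ?_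
  rwa [← C_1, degree_X_pow_add_C hτ]

theorem degree_sum_fin_C_mul_X_pow_lt {R : Type*} [Semiring R] {n : ℕ} (v : Fin n → R) :
    (∑ i, C (v i) * X ^ (i : ℕ)).degree < (n : WithBot ℕ) :=
  mem_degreeLT.1 <| Submodule.sum_mem _ fun i _ => mem_degreeLT.2 <|
    (degree_C_mul_X_pow_le _ _).trans_lt (by exact_mod_cast i.2)

theorem coeff_sum_fin_C_mul_X_pow {R : Type*} [Semiring R] {n : ℕ} (v : Fin n → R) (i : Fin n) :
    (∑ j, C (v j) * X ^ (j : ℕ)).coeff i = v i := by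
  simp [coeff_X_pow, Fin.val_inj]

theorem stmt0 (p s τ m : ℕ) (hp : 1 < p) (hodd : Odd p)
    (hτ : τ = 2 ^ s) (hm : m = p * τ)
    (a : Polynomial (ZMod 2)) (ha : a.degree < (m : WithBot ℕ))
    (hgcd : EuclideanDomain.gcd a (X ^ m + 1 : Polynomial (ZMod 2)) = X ^ τ + 1) :
    IsUnit (Att m τ a) := by
  have hτ0 : 0 < τ := hτ ▸ by positivity
  have hτm : τ ≤ m := hm ▸ Nat.le_mul_of_pos_left τ (by omega)
  have hm0 : 0 < m := hτ0.trans_le hτm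
  have hnm : m = (m - τ) + τ := by omega
  have hga : (X ^ τ + 1 : (ZMod 2)[X]) ∣ a := hgcd ▸ EuclideanDomain.gcd_dvd_left _ _
  have hgm : (X ^ τ + 1 : (ZMod 2)[X]) ∣ X ^ m + 1 := hgcd ▸ EuclideanDomain.gcd_dvd_right _ _
  have hdegτ : (X ^ τ + 1 : (ZMod 2)[X]).degree = τ := by
    rw [← C_1, degree_X_pow_add_C hτ0]
  have hdegm : (X ^ m + 1 : (ZMod 2)[X]).degree = m := by
    rw [← C_1, degree_X_pow_add_C hm0]
  rw [← Matrix.vecMul_injective_iff_isUnit]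
  refine (injective_iff_map_eq_zero (Matrix.vecMulLinear (Att m τ a))).2 fun v hv => ?_
  set V : (ZMod 2)[X] := ∑ i, C (v i) * X ^ (i : ℕ) with hV
  let c : ℕ → ZMod 2 := fun k => ∑ i : Fin (m - τ), v i * a.coeff ((k + (m - i)) % m)
  have hc : ∀ k < m - τ, c k = 0 := fun k hk => congrFun hv ⟨k, hk⟩
  set u : (ZMod 2)[X] := ∑ k : Fin τ, C (c (m - τ + k)) * X ^ (k : ℕ) with hu
  have hS : ∑ k ∈ Finset.range m, C (c k) * X ^ k = X ^ (m - τ) * u := by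
    conv_lhs => rw [hnm]
    rw [Finset.sum_range_add, Finset.sum_eq_zero, zero_add, Finset.sum_range, hu, Finset.mul_sum]
    · exact Finset.sum_congr rfl fun k _ => by ring
    · intro k hk
      simp [hc k (Finset.mem_range.1 hk)]
  have hdvd : (X ^ m + 1 : (ZMod 2)[X]) ∣ V * a - X ^ (m - τ) * u := by
    have : V * a - X ^ (m - τ) * u = ∑ i : Fin (m - τ), C (v i) * (X ^ (i : ℕ) * a -
        ∑ k ∈ Finset.range m, C (a.coeff ((k + (m - i)) % m)) * X ^ k) := by
      simp only [mul_sub, Finset.sum_sub_distrib]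
      rw [← hS, hV, Finset.sum_mul]
      congr 1
      · exact Finset.sum_congr rfl fun i _ => by ring
      · simp only [Finset.mul_sum]
        rw [Finset.sum_comm]
        refine Finset.sum_congr rfl fun k _ => ?_
        simp only [c, map_sum, Finset.sum_mul, C_mul, mul_assoc]
    rw [this, ← CharTwo.sub_eq_add]
    exact Finset.dvd_sum fun i _ =>
      (X_pow_sub_one_dvd_X_pow_mul_sub_rotate (by omega) ha).mul_left _
  have hu0 : u = 0 := eq_zero_of_X_pow_add_one_dvd_X_pow_mul hτ0 (m - τ)
    (degree_sum_fin_C_mul_X_pow_lt _)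
    ((dvd_sub_right (hga.mul_left V)).1 (hgm.trans hdvd))
  rw [hu0, mul_zero, sub_zero] at hdvd
  have hg0 : (X ^ τ + 1 : (ZMod 2)[X]) ≠ 0 := by
    intro h
    simp [h] at hdegτ
  obtain ⟨b, hb⟩ := hga
  obtain ⟨h, hh⟩ := hgm
  have hco : IsCoprime h b := by
    refine ⟨EuclideanDomain.gcdB a (X ^ m + 1), EuclideanDomain.gcdA a (X ^ m + 1),
      mul_left_cancel₀ hg0 ?_⟩
    have := EuclideanDomain.gcd_eq_gcd_ab a (X ^ m + 1)
    rw [hgcd] at this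
    linear_combination -this - EuclideanDomain.gcdB a (X ^ m + 1) * hh -
      EuclideanDomain.gcdA a (X ^ m + 1) * hb
  have hhV : h ∣ V := by
    refine hco.dvd_of_dvd_mul_right ((mul_dvd_mul_iff_left hg0).1 ?_)
    rwa [← hh, mul_left_comm, ← hb]
  have hdegh : h.degree = ((m - τ : ℕ) : WithBot ℕ) := by
    have hh0 : h ≠ 0 := by
      rintro rfl
      simp [hh] at hdegm
    have := congrArg degree hh
    rw [degree_mul, hdegτ, hdegm, degree_eq_natDegree hh0] at this
    rw [degree_eq_natDegree hh0]
    norm_cast at this ⊢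
    omega
  have hV0 : V = 0 := eq_zero_of_dvd_of_degree_lt hhV
    (hdegh ▸ degree_sum_fin_C_mul_X_pow_lt v)
  funext i
  rw [← coeff_sum_fin_C_mul_X_pow v i, ← hV, hV0]
  simp
end

section
/- Let ℓ₀≥2, ℓ₁≥2, and for 0≤i<ℓ₀, 0≤j<ℓ₁ let a_{i,j} ∈ 𝔽₂[x] have degree < m and suppose x^τ+1 divides a_{i,j}+a_{i,k} in 𝔽₂[x] for all i and all 0≤j,k<ℓ₁. Let 𝐚_{i,j} ∈ 𝔽₂^m denote the coefficient vector of a_{i,j} and let 𝐚̄_{i,j} ∈ 𝔽₂^{m−τ} denote the vector obtained from 𝐚_{i,j} by deleting its last τ entries. If there exist c₀,…,c_{ℓ₀−1} ∈ 𝔽₂, not all zero, with Σ_{i=0}^{ℓ₀−1} c_i·(𝐚̄_{i,0},…,𝐚̄_{i,ℓ₁−1}) = 0 in 𝔽₂^{(m−τ)ℓ₁}, then there exists a vector u ∈ 𝔽₂^τ such that Σ_{i=0}^{ℓ₀−1} c_i·(𝐚_{i,0},…,𝐚_{i,ℓ₁−1}) = (0_{m−τ}, u | 0_{m−τ}, u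 | … | 0_{m−τ}, u), i.e., every one of the ℓ₁ blocks of length m equals (0_{m−τ}, u). -/
open Polynomial Finset

/-- A multiple of `X ^ τ + 1` of degree less than `n + τ` whose first `n` coefficients vanish
is zero. -/
theorem eq_zero_of_X_pow_add_one_dvd {R : Type*} [CommRing R] [IsDomain R] {n τ : ℕ}
    (hτ : 0 < τ) {f : R[X]} (hdvd : X ^ τ + 1 ∣ f) (hcoeff : ∀ t < n, f.coeff t = 0)
    (hdeg : f.degree < ((n + τ : ℕ) : WithBot ℕ)) : f = 0 := by
  have hcop : IsCoprime (X ^ τ + 1 : R[X]) (X ^ n) := by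
    apply IsCoprime.pow_right
    refine ⟨1, -X ^ (τ - 1), ?_⟩
    have h : (X : R[X]) ^ (τ - 1) * X = X ^ τ := by
      rw [← pow_succ, Nat.sub_add_cancel hτ]
    linear_combination -h
  have hmul := hcop.mul_dvd hdvd (X_pow_dvd_iff.mpr hcoeff)
  refine eq_zero_of_dvd_of_degree_lt hmul ?_
  have h1 : (X ^ τ + 1 : R[X]).degree = τ := by
    simpa using degree_X_pow_add_C hτ (1 : R)
  rw [degree_mul, h1, degree_X_pow]
  convert hdeg using 1
  push_cast
  exact add_comm _ _

theorem stmt2 (p s τ m : ℕ) (hp : 1 < p) (hodd : Odd p)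
    (hτ : τ = 2 ^ s) (hm : m = p * τ)
    (ℓ₀ ℓ₁ : ℕ) (hℓ₀ : 2 ≤ ℓ₀) (hℓ₁ : 2 ≤ ℓ₁)
    (a : Fin ℓ₀ → Fin ℓ₁ → Polynomial (ZMod 2))
    (hdeg : ∀ i j, (a i j).degree < (m : WithBot ℕ))
    (hdvd : ∀ (i : Fin ℓ₀) (j k : Fin ℓ₁),
      (X ^ τ + 1 : Polynomial (ZMod 2)) ∣ (a i j + a i k))
    (c : Fin ℓ₀ → ZMod 2) (hc : c ≠ 0)
    (hker : ∀ (j : Fin ℓ₁) (t : Fin (m - τ)),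
      ∑ i : Fin ℓ₀, c i * (a i j).coeff t.1 = 0) :
    ∃ u : Fin τ → ZMod 2, ∀ j : Fin ℓ₁,
      (∀ t : Fin (m - τ), ∑ i : Fin ℓ₀, c i * (a i j).coeff t.1 = 0) ∧
      (∀ t : Fin τ, ∑ i : Fin ℓ₀, c i * (a i j).coeff (m - τ + t.1) = u t) := by
  have hτpos : 0 < τ := by rw [hτ]; positivity
  have hτm : τ ≤ m := by rw [hm]; exact Nat.le_mul_of_pos_left τ (by lia)
  let j₀ : Fin ℓ₁ := ⟨0, by lia⟩
  refine ⟨fun t => ∑ i, c i * (a i j₀).coeff (m - τ + t.1), fun j => ⟨hker j, fun t => ?_⟩⟩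
  have hcoeff : ∀ t, (∑ i, C (c i) * (a i j + a i j₀)).coeff t =
      ∑ i, c i * (a i j).coeff t + ∑ i, c i * (a i j₀).coeff t := by
    intro t
    simp only [finsetSum_coeff, coeff_C_mul, coeff_add, mul_add, sum_add_distrib]
  have hzero : ∑ i, C (c i) * (a i j + a i j₀) = 0 := by
    refine eq_zero_of_X_pow_add_one_dvd (n := m - τ) hτpos
      (dvd_sum fun i _ => (hdvd i j j₀).mul_left _) ?_ ?_
    · intro t ht
      rw [hcoeff, hker j ⟨t, ht⟩, hker j₀ ⟨t, ht⟩, add_zero]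
    · rw [Nat.sub_add_cancel hτm, ← mem_degreeLT]
      refine Submodule.sum_mem _ fun i _ => ?_
      rw [← smul_eq_C_mul]
      exact Submodule.smul_mem _ _
        (Submodule.add_mem _ (mem_degreeLT.mpr (hdeg i j)) (mem_degreeLT.mpr (hdeg i j₀)))
  have h := hcoeff (m - τ + t.1)
  rw [hzero, coeff_zero] at h
  exact CharTwo.add_eq_zero.mp h.symm
end

section
/- Let ℓ₀≥2, ℓ₁≥2, and for 0≤i<ℓ₀, 0≤j<ℓ₁ let a_{i,j} ∈ 𝔽₂[x] have degree < m and suppose x^τ+1 divides a_{i,j} in 𝔽₂[x] for all i,j. Let 𝐚_{i,j} ∈ 𝔽₂^m denote the coefficient vector of a_{i,j} and let 𝐚̄_{i,j} ∈ 𝔽₂^{m−τ} denote the vector obtained from 𝐚_{i,j} by deleting its last τ entries. If c₀,…,c_{ℓ₀−1} ∈ 𝔽₂ satisfy Σ_{i=0}^{ℓ₀−1} c_i·(𝐚̄_{i,0},…,𝐚̄_{i,ℓ₁−1}) = 0 in 𝔽₂^{(m−τ)ℓ₁}, then Σ_{i=0}^{ℓ₀−1} c_i·(𝐚_{i,0},…,𝐚_{i,ℓ₁−1})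 = 0 in 𝔽₂^{mℓ₁}. -/
open Polynomial Finset

theorem isCoprime_X_pow_X_pow_add_one {R : Type*} [CommRing R] (k : ℕ) {n : ℕ} (hn : n ≠ 0) :
    IsCoprime (X ^ k : R[X]) (X ^ n + 1) := by
  refine IsCoprime.pow_left ⟨-X ^ (n - 1), 1, ?_⟩
  have h : (X : R[X]) ^ (n - 1) * X = X ^ n := pow_sub_one_mul hn X
  linear_combination -h

/-- A multiple of `X ^ n + 1` of degree less than `k + n` is determined by its `k` lowest
coefficients. -/
theorem eq_zero_of_X_pow_add_one_dvd_s3 {K : Type*} [Field K] {k n : ℕ} (hn : n ≠ 0) {b : K[X]}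
    (hdvd : X ^ n + 1 ∣ b) (hdeg : b.degree < ((k + n : ℕ) : WithBot ℕ))
    (hlow : ∀ t < k, b.coeff t = 0) : b = 0 := by
  refine eq_zero_of_dvd_of_degree_lt
    ((isCoprime_X_pow_X_pow_add_one k hn).mul_dvd (X_pow_dvd_iff.2 hlow) hdvd) ?_
  have h : (X ^ n + 1 : K[X]).degree = n := by
    simpa using degree_X_pow_add_C (Nat.pos_of_ne_zero hn) (1 : K)
  rw [degree_mul, degree_X_pow, h]
  exact_mod_cast hdeg

theorem stmt3 (p s τ m : ℕ) (hp : 1 < p) (hodd : Odd p)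
    (hτ : τ = 2 ^ s) (hm : m = p * τ)
    (ℓ₀ ℓ₁ : ℕ) (hℓ₀ : 2 ≤ ℓ₀) (hℓ₁ : 2 ≤ ℓ₁)
    (a : Fin ℓ₀ → Fin ℓ₁ → Polynomial (ZMod 2))
    (hdeg : ∀ i j, (a i j).degree < (m : WithBot ℕ))
    (hdvd : ∀ (i : Fin ℓ₀) (j : Fin ℓ₁),
      (X ^ τ + 1 : Polynomial (ZMod 2)) ∣ a i j)
    (c : Fin ℓ₀ → ZMod 2)
    (hker : ∀ (j : Fin ℓ₁) (t : Fin (m - τ)),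
      ∑ i : Fin ℓ₀, c i * (a i j).coeff t.1 = 0) :
    ∀ (j : Fin ℓ₁) (t : ℕ), t < m → ∑ i : Fin ℓ₀, c i * (a i j).coeff t = 0 := by
  intro j t _
  have hcoeff (t : ℕ) : (∑ i, C (c i) * a i j).coeff t = ∑ i, c i * (a i j).coeff t := by
    simp
  have hτ₀ : τ ≠ 0 := by simp [hτ]
  have hle : τ ≤ m := hm ▸ Nat.le_mul_of_pos_left τ (by omega)
  have hzero : ∑ i, C (c i) * a i j = 0 := by
    refine eq_zero_of_X_pow_add_one_dvd_s3 (k := m - τ) hτ₀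
      (dvd_sum fun i _ => (hdvd i j).mul_left _) ?_ fun t ht => ?_
    · rw [Nat.sub_add_cancel hle, ← mem_degreeLT]
      refine Submodule.sum_mem _ fun i _ => ?_
      rw [← smul_eq_C_mul]
      exact Submodule.smul_mem _ _ (mem_degreeLT.2 (hdeg i j))
    · rw [hcoeff]
      exact hker j ⟨t, ht⟩
  rw [← hcoeff, hzero, coeff_zero]
end

section
/- Let ℓ≥2 and let V=[v_{i,j}] be an ℓ×ℓ matrix over R=𝔽₂[x]/⟨x^m+1⟩ such that: (1) the determinant of V is coprime with f_{p,τ}(x) in 𝔽₂[x] (i.e., V is invertible modulo f_{p,τ}(x)); (2) for every 0≤i<ℓ, the (m−τ)×ℓ(m−τ) binary matrix [𝒜_{τ,τ}(v_{i,0}) | 𝒜_{τ,τ}(v_{i,1}) | … | 𝒜_{τ,τ}(v_{i,ℓ−1})] has full row rank m−τ over 𝔽₂; (3) x^τ+1 divides v_{i,j} for all 0≤i,j<ℓ. Then the ℓ(m−τ)×ℓ(m−τ) binary matrix 𝒯_{ℓ,ℓ,m}(V) has full rank over 𝔽₂ (i.e., it is invertible). -/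
open Polynomial

/-- The block matrix `𝒯(B) = [𝒜_{τ,τ}(b_{i,j})]`. -/
noncomputable def Tmap {I J : Type*} (m τ : ℕ)
    (B : Matrix I J (Polynomial (ZMod 2))) :
    Matrix (I × Fin (m - τ)) (J × Fin (m - τ)) (ZMod 2) :=
  Matrix.of fun r c => Att m τ (B r.1 c.1) r.2 c.2

/-- `f_{p,τ}(x) = 1 + x^τ + ⋯ + x^{(p-1)τ}` over `𝔽₂`. -/
noncomputable def fpoly (p τ : ℕ) : Polynomial (ZMod 2) :=
  ∑ i ∈ Finset.range p, Polynomial.X ^ (i * τ)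

theorem X_pow_add_one_eq_sub_one (n : ℕ) : (X ^ n + 1 : (ZMod 2)[X]) = X ^ n - 1 := by
  rw [sub_eq_add_neg, CharTwo.neg_eq]

/-- The representative of degree `< m` of `x ^ t * a` modulo `x ^ m + 1`: the polynomial whose
coefficients form row `t` of the circulant matrix of `a`. -/
noncomputable def circulantRow (m t : ℕ) (a : (ZMod 2)[X]) : (ZMod 2)[X] :=
  ∑ k ∈ Finset.range m, C (a.coeff ((k + (m - t)) % m)) * X ^ k

theorem coeff_circulantRow (m t : ℕ) (a : (ZMod 2)[X]) (k : ℕ) :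
    (circulantRow m t a).coeff k = if k < m then a.coeff ((k + (m - t)) % m) else 0 := by
  simp [circulantRow, finsetSum_coeff, coeff_X_pow]

theorem X_pow_sub_one_dvd_X_pow_sub_X_pow_mod_s4 (m n : ℕ) :
    (X ^ m - 1 : (ZMod 2)[X]) ∣ X ^ n - X ^ (n % m) := by
  conv_rhs => rw [← Nat.mod_add_div n m]
  have h : (X ^ m - 1 : (ZMod 2)[X]) ∣ (X ^ m) ^ (n / m) - 1 := by
    simpa using sub_dvd_pow_sub_pow (X ^ m : (ZMod 2)[X]) 1 (n / m)
  have e : (X ^ (n % m + m * (n / m)) - X ^ ((n % m + m * (n / m)) % m) : (ZMod 2)[X])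
      = X ^ (n % m) * ((X ^ m) ^ (n / m) - 1) := by
    rw [Nat.mod_add_div, ← pow_mul, mul_sub, ← pow_add, Nat.mod_add_div, mul_one]
  rw [e]
  exact h.mul_left _

theorem circulantRow_eq_sum (m t : ℕ) (ht : t < m) (a : (ZMod 2)[X]) :
    circulantRow m t a = ∑ n ∈ Finset.range m, C (a.coeff n) * X ^ ((t + n) % m) := by
  have hm : 0 < m := by omega
  have key : ∀ k < m, (t + (k + (m - t)) % m) % m = k := by
    intro k hk
    rw [Nat.add_mod_mod, show t + (k + (m - t)) = k + m by omega, Nat.add_mod_right,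
      Nat.mod_eq_of_lt hk]
  have key' : ∀ n < m, ((t + n) % m + (m - t)) % m = n := by
    intro n hn
    rw [Nat.mod_add_mod, show t + n + (m - t) = n + m by omega, Nat.add_mod_right,
      Nat.mod_eq_of_lt hn]
  refine Finset.sum_nbij' (fun k => (k + (m - t)) % m) (fun n => (t + n) % m) ?_ ?_ ?_ ?_ ?_
  · exact fun k _ => Finset.mem_range.2 (Nat.mod_lt _ hm)
  · exact fun k _ => Finset.mem_range.2 (Nat.mod_lt _ hm)
  · exact fun k hk => key k (Finset.mem_range.1 hk)
  · exact fun n hn => key' n (Finset.mem_range.1 hn)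
  · intro k hk
    simp only [key k (Finset.mem_range.1 hk)]

theorem X_pow_sub_one_dvd_X_pow_mul_sub_circulantRow (m t : ℕ) (ht : t < m) (a : (ZMod 2)[X])
    (ha : a.degree < (m : WithBot ℕ)) :
    (X ^ m - 1 : (ZMod 2)[X]) ∣ X ^ t * a - circulantRow m t a := by
  have e : X ^ t * a = ∑ n ∈ Finset.range m, C (a.coeff n) * X ^ (t + n) := by
    have hm : a.natDegree < m := by
      by_cases h0 : a = 0
      · simp only [h0, natDegree_zero]; omega
      · exact (natDegree_lt_iff_degree_lt h0).2 ha
    conv_lhs => rw [as_sum_range_C_mul_X_pow' a hm]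
    rw [Finset.mul_sum]
    exact Finset.sum_congr rfl fun n _ => by ring
  rw [e, circulantRow_eq_sum m t ht, ← Finset.sum_sub_distrib]
  refine Finset.dvd_sum fun n _ => ?_
  rw [← mul_sub]
  exact (X_pow_sub_one_dvd_X_pow_sub_X_pow_mod_s4 m (t + n)).mul_left _

theorem eq_zero_of_X_pow_sub_one_dvd {m τ : ℕ} (hτ : 0 < τ) (hle : τ ≤ m) {Q : (ZMod 2)[X]}
    (hlow : ∀ k < m - τ, Q.coeff k = 0) (hhigh : ∀ k, m ≤ k → Q.coeff k = 0)
    (hdvd : (X ^ τ - 1 : (ZMod 2)[X]) ∣ Q) : Q = 0 := by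
  obtain ⟨g, rfl⟩ := X_pow_dvd_iff.2 hlow
  have hcop : IsCoprime (X ^ τ - 1 : (ZMod 2)[X]) (X ^ (m - τ)) := by
    refine IsCoprime.pow_right ⟨-1, X ^ (τ - 1), ?_⟩
    rw [← pow_succ, Nat.sub_add_cancel hτ]
    ring
  have hg : (X ^ τ - 1 : (ZMod 2)[X]) ∣ g := hcop.dvd_of_dvd_mul_left hdvd
  have hdeg : g.degree < (τ : WithBot ℕ) := by
    refine (degree_lt_iff_coeff_zero _ _).2 fun k hk => ?_
    have := hhigh (k + (m - τ)) (by omega)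
    rwa [coeff_X_pow_mul] at this
  have hg0 : g = 0 := by
    refine eq_zero_of_dvd_of_degree_lt hg ?_
    rwa [← C_1, degree_X_pow_sub_C hτ]
  rw [hg0, mul_zero]

theorem fpoly_mul (p τ : ℕ) : fpoly p τ * (X ^ τ - 1) = X ^ (p * τ) - 1 := by
  have h := geom_sum_mul (X ^ τ : (ZMod 2)[X]) p
  simp only [← pow_mul] at h
  simpa only [fpoly, mul_comm τ] using h

theorem degree_fpoly {p τ : ℕ} (hp : 0 < p) (hτ : 0 < τ) :
    (fpoly p τ).degree = ((p * τ - τ : ℕ) : WithBot ℕ) := by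
  have h := fpoly_mul p τ
  have hne : (X ^ (p * τ) - 1 : (ZMod 2)[X]) ≠ 0 := by
    simpa using X_pow_sub_C_ne_zero (Nat.mul_pos hp hτ) (1 : ZMod 2)
  have hf : fpoly p τ ≠ 0 := fun h0 => hne (by rw [← h, h0, zero_mul])
  have hx : (X ^ τ - 1 : (ZMod 2)[X]) ≠ 0 := fun h0 => hne (by rw [← h, h0, mul_zero])
  have hd := congrArg natDegree h
  rw [natDegree_mul hf hx, ← C_1, natDegree_X_pow_sub_C, natDegree_X_pow_sub_C] at hd
  rw [degree_eq_natDegree hf]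
  congr 1
  omega

theorem dvd_of_dvd_vecMul {R n : Type*} [CommRing R] [Fintype n] [DecidableEq n]
    {f : R} {V : Matrix n n R} (hV : IsCoprime V.det f) {w : n → R}
    (h : ∀ j, f ∣ Matrix.vecMul w V j) (i : n) : f ∣ w i := by
  have e : Matrix.vecMul (Matrix.vecMul w V) V.adjugate i = V.det * w i := by
    rw [Matrix.vecMul_vecMul, Matrix.mul_adjugate, Matrix.vecMul_smul, Matrix.vecMul_one,
      Pi.smul_apply, smul_eq_mul]
  refine hV.symm.dvd_of_dvd_mul_left ?_
  rw [← e]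
  exact Finset.dvd_sum fun j _ => (h j).mul_right _

theorem stmt4 (p s τ m : ℕ) (hp : 1 < p) (hodd : Odd p)
    (hτ : τ = 2 ^ s) (hm : m = p * τ)
    (ℓ : ℕ) (hℓ : 2 ≤ ℓ)
    (V : Matrix (Fin ℓ) (Fin ℓ) (Polynomial (ZMod 2)))
    (hdeg : ∀ i j, (V i j).degree < (m : WithBot ℕ))
    (h1 : IsCoprime V.det (fpoly p τ))
    (h2 : ∀ i : Fin ℓ,
      (Matrix.of fun (t : Fin (m - τ)) (q : Fin ℓ × Fin (m - τ)) =>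
        Att m τ (V i q.1) t q.2).rank = m - τ)
    (h3 : ∀ i j : Fin ℓ, (X ^ τ + 1 : Polynomial (ZMod 2)) ∣ V i j) :
    IsUnit (Tmap m τ V) := by
  subst hm
  have hτ0 : 0 < τ := hτ ▸ Nat.two_pow_pos s
  have hp0 : 0 < p := by omega
  have hle : τ ≤ p * τ := Nat.le_mul_of_pos_left τ hp0
  set m := p * τ with hm
  simp only [X_pow_add_one_eq_sub_one] at h3
  rw [← Matrix.vecMul_injective_iff_isUnit]
  refine (injective_iff_map_eq_zero (Matrix.vecMulLinear (Tmap m τ V))).2 fun w hw => ?_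
  let W : Fin ℓ → (ZMod 2)[X] := fun i => ∑ t : Fin (m - τ), C (w (i, t)) * X ^ t.1
  let Q : Fin ℓ → (ZMod 2)[X] := fun j =>
    ∑ i, ∑ t : Fin (m - τ), C (w (i, t)) * circulantRow m t.1 (V i j)
  have hWQ : ∀ j, (X ^ m - 1 : (ZMod 2)[X]) ∣ Matrix.vecMul W V j - Q j := by
    intro j
    simp only [Matrix.vecMul, dotProduct, W, Q, Finset.sum_mul, ← Finset.sum_sub_distrib]
    refine Finset.dvd_sum fun i _ => Finset.dvd_sum fun t _ => ?_
    rw [mul_assoc, ← mul_sub]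
    exact (X_pow_sub_one_dvd_X_pow_mul_sub_circulantRow m t.1 (by omega) _ (hdeg i j)).mul_left _
  have hQ : ∀ j, Q j = 0 := by
    intro j
    refine eq_zero_of_X_pow_sub_one_dvd hτ0 hle (fun k hk => ?_) (fun k hk => ?_) ?_
    · have hk' : k < m := by omega
      have := congrFun hw (j, ⟨k, hk⟩)
      simpa [Matrix.vecMul, dotProduct, Tmap, Att, Q, finsetSum_coeff, coeff_circulantRow, hk',
        Fintype.sum_prod_type] using this
    · simp [Q, finsetSum_coeff, coeff_circulantRow, hk.not_gt]
    · have hW : (X ^ τ - 1 : (ZMod 2)[X]) ∣ Matrix.vecMul W V j := by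
        rw [Matrix.vecMul, dotProduct]
        exact Finset.dvd_sum fun i _ => (h3 i j).mul_left _
      exact (dvd_sub_right hW).1 ((Dvd.intro_left _ (fpoly_mul p τ)).trans (hWQ j))
  have hW0 : ∀ i, W i = 0 := by
    intro i
    have hf : fpoly p τ ∣ W i := dvd_of_dvd_vecMul h1 (fun j => by
      have := hWQ j
      rw [hQ, sub_zero] at this
      exact (Dvd.intro _ (fpoly_mul p τ)).trans this) i
    refine eq_zero_of_dvd_of_degree_lt hf ?_
    rw [degree_fpoly hp0 hτ0]
    exact degree_sum_fin_lt fun t => w (i, t)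
  ext ⟨i, t⟩
  have := congrArg (coeff · t.1) (hW0 i)
  simpa [W, finsetSum_coeff, coeff_X_pow, Fin.val_inj] using this
end

section
/- Let A be a commutative ring of characteristic 2, x ∈ A, n₀≥1, and z₀,…,z_{2^{n₀}−1} ∈ A. For 0≤j<2^{n₀} write j = Σ_t j_t·2^t in binary and define h'_j = Σ_{t=0}^{n₀−1} j_t·x^t ∈ A. For 0≤s<n₀ let y_{2^s} = Σ_{j : j_s = 1} z_j (the sum over all j whose s-th binary digit is 1; these are entries of the Reed–Muller transform y = R_{n₀}·z). Then for every integer t≥0, Σ_{j=0}^{2^{n₀}−1} (h'_j)^{2^t} · z_j = Σ_{s=0}^{n₀−1} x^{s·2^t} · y_{2^s}; moreover Σ_{j=0}^{2^{n₀}−1} z_j = y₀ where y₀ = Σ_j z_j. (This is the case b(i)≤1 of the Reed–Muller-based evaluation formula P(i,{z_j}) = Σ_j (h'_j)^i z_j used in the fast syndrome computation.) -/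
open Finset

theorem stmt19 (A : Type*) [CommRing A] [CharP A 2] (x : A)
    (n₀ : ℕ) (hn₀ : 1 ≤ n₀) (z : ℕ → A)
    -- `y k = Σ_{j : k AND j = k} z j`, the entries of the Reed–Muller transform
    (y : ℕ → A)
    (hy : ∀ k : ℕ, y k = ∑ j ∈ (Finset.range (2 ^ n₀)).filter (fun j => k &&& j = k), z j) :
    (∀ t : ℕ,
      ∑ j ∈ Finset.range (2 ^ n₀),
        (∑ u ∈ Finset.range n₀, if Nat.testBit j u then x ^ u else 0) ^ (2 ^ t) * z j
        = ∑ u ∈ Finset.range n₀, x ^ (u * 2 ^ t) * y (2 ^ u)) ∧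
    (∑ j ∈ Finset.range (2 ^ n₀), z j = y 0) := by
  have : Fact (Nat.Prime 2) := ⟨Nat.prime_two⟩
  refine ⟨fun t => ?_, by simp [hy]⟩
  have digit (u j : ℕ) : 2 ^ u &&& j = 2 ^ u ↔ j.testBit u = true := by
    rw [Nat.two_pow_and]
    cases j.testBit u <;> simp [(Nat.two_pow_pos u).ne]
  simp_rw [sum_pow_char_pow, Finset.sum_mul, hy, digit, Finset.sum_filter, Finset.mul_sum]
  rw [Finset.sum_comm]
  refine Finset.sum_congr rfl fun u _ => Finset.sum_congr rfl fun j _ => ?_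
  split_ifs
  · rw [pow_mul]
  · simp
end
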